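/- Monotonicity and Lipschitz continuity of the numerical Hamiltonian in its second argument: let r ≥ 0, Δv > 0, v_1,…,v_{N_v} ∈ ℝ, M_1,…,M_{N_v} > 0, and set v_max = max_j |v_j|. Suppose p ∈ ℝ, q ≤ q', and h, h' ∈ ℝ satisfy, with all denominators positive, Δv·Σ_j M_j/(1 + r + h − max(v_j,0)·p − min(v_j,0)·q) = 1/(1+r) and Δv·Σ_j M_j/(1 + r + h' − max(v_j,0)·p − min(v_j,0)·q') = 1/(1+r). Then h − v_max·(q' − q) ≤ h' ≤ h. -/

import Mathlib

/-- Two equal sums of positive weights over positive denominators cannot have strictly ordered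
denominators. -/
theorem exists_le_of_sum_div_eq {ι : Type*} [Fintype ι] [Nonempty ι] {M D E : ι → ℝ}
    (hM : ∀ j, 0 < M j) (hD : ∀ j, 0 < D j)
    (h : ∑ j, M j / D j = ∑ j, M j / E j) : ∃ j, E j ≤ D j := by
  by_contra! hlt
  exact (Finset.sum_lt_sum_of_nonempty Finset.univ_nonempty
    fun j _ => div_lt_div_of_pos_left (hM j) (hD j) (hlt j)).ne' h

/-- Monotonicity and Lipschitz continuity of the numerical Hamiltonian in its
second argument. -/
theorem numerical_hamiltonian_second_arg
    (r Δv : ℝ) (Nv : ℕ)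
    (hr : 0 ≤ r) (hΔv : 0 < Δv) (hNv : 1 ≤ Nv)
    (v M : Fin Nv → ℝ) (hM : ∀ j, 0 < M j)
    (vmax : ℝ)
    (hvmax : vmax = Finset.univ.sup'
      (Finset.univ_nonempty_iff.mpr (Fin.pos_iff_nonempty.mp (by omega)))
      (fun j => |v j|))
    (p q q' h h' : ℝ) (hqq' : q ≤ q')
    (hden : ∀ j, 0 < 1 + r + h - max (v j) 0 * p - min (v j) 0 * q)
    (hden' : ∀ j, 0 < 1 + r + h' - max (v j) 0 * p - min (v j) 0 * q')
    (heq : Δv * ∑ j, M j / (1 + r + h - max (v j) 0 * p - min (v j) 0 * q)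
      = 1 / (1 + r))
    (heq' : Δv * ∑ j, M j / (1 + r + h' - max (v j) 0 * p - min (v j) 0 * q')
      = 1 / (1 + r)) :
    h - vmax * (q' - q) ≤ h' ∧ h' ≤ h := by
  have : Nonempty (Fin Nv) := Fin.pos_iff_nonempty.mp hNv
  have hsum := mul_left_cancel₀ hΔv.ne' (heq.trans heq'.symm)
  constructor
  · obtain ⟨j, hj⟩ := exists_le_of_sum_div_eq hM hden' hsum.symm
    have hv : |v j| ≤ vmax := by
      rw [hvmax]
      exact Finset.le_sup' (fun j => |v j|) (Finset.mem_univ j)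
    have hmin : -min (v j) 0 ≤ vmax := by
      rcases min_cases (v j) 0 with ⟨h₁, -⟩ | ⟨h₁, -⟩ <;> rw [h₁]
      · exact (neg_le_abs _).trans hv
      · simpa using (abs_nonneg _).trans hv
    nlinarith [mul_le_mul_of_nonneg_right hmin (sub_nonneg.2 hqq')]
  · obtain ⟨j, hj⟩ := exists_le_of_sum_div_eq hM hden hsum
    nlinarith [mul_nonneg (neg_nonneg.2 (min_le_right (v j) 0)) (sub_nonneg.2 hqq')]
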